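/- Let T be a finite tree with a distinguished root vertex r, with edges directed away from r (so each non-root vertex has a unique parent), and let t ≥ 2. Then the path ideal I_t(T), the squarefree monomial ideal whose minimal generators are the vertex sets {v_1, ..., v_t} of directed paths v_1 → v_2 → ⋯ → v_t in T (each v_{i+1} a child of v_i), is bridge-friendly (assuming T contains at least one such path). -/

import Mathlib

/-- The "lcm" of a collection of supports of squarefree monomials: the union. -/
def lcmU {α : Type*} [DecidableEq α] (σ : Finset (Finset α)) : Finset α := σ.sup id

/-- `m` is a bridge of `σ`: `m ∈ σ` and removing `m` does not change the lcm. -/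
def IsBridge {α : Type*} [DecidableEq α] (σ : Finset (Finset α)) (m : Finset α) : Prop :=
  m ∈ σ ∧ lcmU (σ.erase m) = lcmU σ

/-- `m` is a gap of `σ` (relative to the generating set `M`): `m ∈ M`, `m ∉ σ`,
and adding `m` does not change the lcm. -/
def IsGap {α : Type*} [DecidableEq α] (M : Set (Finset α)) (σ : Finset (Finset α))
    (m : Finset α) : Prop :=
  m ∈ M ∧ m ∉ σ ∧ lcmU (insert m σ) = lcmU σ

/-- `m` is a true gap of `σ` w.r.t. the total order encoded by `ord`
(`a` dominates `b` iff `ord b < ord a`). -/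
def IsTrueGap {α : Type*} [DecidableEq α] (M : Set (Finset α)) (ord : Finset α → ℕ)
    (σ : Finset (Finset α)) (m : Finset α) : Prop :=
  IsGap M σ m ∧ ∀ m', IsBridge (insert m σ) m' → ord m' < ord m → IsBridge σ m'

/-- `σ` is potentially-type-2: it has a bridge dominating no true gap of `σ`. -/
def PotType2 {α : Type*} [DecidableEq α] (M : Set (Finset α)) (ord : Finset α → ℕ)
    (σ : Finset (Finset α)) : Prop :=
  ∃ m, IsBridge σ m ∧ ∀ g, IsTrueGap M ord σ g → ¬ ord g < ord m

/-- `b` is the smallest bridge of `σ` w.r.t. the total order encoded by `ord`. -/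
def IsSBridge {α : Type*} [DecidableEq α] (ord : Finset α → ℕ) (σ : Finset (Finset α))
    (b : Finset α) : Prop :=
  IsBridge σ b ∧ ∀ b', IsBridge σ b' → ord b ≤ ord b'

/-- `σ` is type-2: it is potentially-type-2, and any other potentially-type-2 `σ'` with
`σ' \ {sbridge σ'} = σ \ {sbridge σ}` satisfies `sbridge σ' ≻ sbridge σ`. -/
def Type2 {α : Type*} [DecidableEq α] (M : Set (Finset α)) (ord : Finset α → ℕ)
    (σ : Finset (Finset α)) : Prop :=
  PotType2 M ord σ ∧ ∀ σ' : Finset (Finset α), ↑σ' ⊆ M → σ' ≠ σ → PotType2 M ord σ' →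
    ∀ b b', IsSBridge ord σ b → IsSBridge ord σ' b' → σ'.erase b' = σ.erase b →
      ord b < ord b'

/-- `M` (an antichain of supports of the minimal generators of a squarefree monomial
ideal) is bridge-friendly: there is a total order on `M` (encoded by an injection
`ord : Finset α → ℕ`, where `a ≻ b` iff `ord b < ord a`) for which every
potentially-type-2 subset of `M` is type-2. -/
def BridgeFriendly {α : Type*} [DecidableEq α] (M : Set (Finset α)) : Prop :=
  ∃ ord : Finset α → ℕ, Set.InjOn ord M ∧
    ∀ σ : Finset (Finset α), ↑σ ⊆ M → PotType2 M ord σ → Type2 M ord σ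

/-- In the tree `T` rooted at `r` (edges directed away from `r`), `u` is the parent of
`v`. -/
def IsParent {V : Type*} (T : SimpleGraph V) (r u v : V) : Prop :=
  T.Adj u v ∧ T.dist r u + 1 = T.dist r v

section Bridges

variable {α : Type*} [DecidableEq α]

theorem mem_lcmU {σ : Finset (Finset α)} {x : α} : x ∈ lcmU σ ↔ ∃ s ∈ σ, x ∈ s := by
  simp [lcmU, Finset.mem_sup]

theorem isBridge_iff {σ : Finset (Finset α)} {m : Finset α} :
    IsBridge σ m ↔ m ∈ σ ∧ ∀ x ∈ m, ∃ s ∈ σ, s ≠ m ∧ x ∈ s := by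
  refine and_congr_right fun hm => ⟨fun h x hx => ?_, fun h => ?_⟩
  · have : x ∈ lcmU (σ.erase m) := h ▸ mem_lcmU.2 ⟨m, hm, hx⟩
    obtain ⟨s, hs, hxs⟩ := mem_lcmU.1 this
    exact ⟨s, (Finset.mem_erase.1 hs).2, (Finset.mem_erase.1 hs).1, hxs⟩
  · ext x
    simp only [mem_lcmU, Finset.mem_erase]
    constructor
    · rintro ⟨s, ⟨-, hs⟩, hx⟩
      exact ⟨s, hs, hx⟩
    · rintro ⟨s, hs, hx⟩
      by_cases hsm : s = m
      · obtain ⟨s', hs', hne, hx'⟩ := h x (hsm ▸ hx)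
        exact ⟨s', ⟨hne, hs'⟩, hx'⟩
      · exact ⟨s, ⟨hsm, hs⟩, hx⟩

theorem lcmU_insert_of_subset {σ : Finset (Finset α)} {m : Finset α} (h : m ⊆ lcmU σ) :
    lcmU (insert m σ) = lcmU σ := by
  simpa [lcmU, Finset.sup_insert] using h

/-- If the traces on `m` of any two generators dominating `m` are comparable, then the order
witnesses bridge-friendliness. -/
theorem bridgeFriendly_of_comparable_traces {M : Set (Finset α)} (ord : Finset α → ℕ)
    (hinj : Set.InjOn ord M)
    (hcomp : ∀ m ∈ M, ∀ b ∈ M, ∀ c ∈ M, ord m < ord b → ord m < ord c →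
      m ∩ b ⊆ c ∨ m ∩ c ⊆ b) :
    BridgeFriendly M := by
  refine ⟨ord, hinj, fun σ hσ hpot => ⟨hpot, ?_⟩⟩
  intro σ' hσ' hne _ b b' hb hb' heq
  by_contra! hle
  have hbσ := hb.1.1
  have hbσ' := hb'.1.1
  have hbb : b' ≠ b := by
    rintro rfl
    exact hne (by rw [← Finset.insert_erase hbσ', heq, Finset.insert_erase hbσ])
  have hlt : ord b' < ord b :=
    lt_of_le_of_ne hle fun h => hbb (hinj (hσ' hbσ') (hσ hbσ) h)
  have hmem : ∀ s, s ≠ b → s ≠ b' → (s ∈ σ ↔ s ∈ σ') := fun s h1 h2 => by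
    have := congrArg (s ∈ ·) heq
    simpa [h1, h2] using this.symm
  have hb'σ : b' ∉ σ := fun h => by
    have : b' ∈ σ'.erase b' := heq ▸ Finset.mem_erase.2 ⟨hbb, h⟩
    simp at this
  have hlcm : lcmU (insert b' σ) = lcmU σ := by
    refine lcmU_insert_of_subset ?_
    rw [← hb.1.2, ← heq, hb'.1.2]
    exact fun x hx => mem_lcmU.2 ⟨b', hbσ', hx⟩
  obtain ⟨m₀, hm₀, hgap⟩ := hpot
  have hnot := hgap b'
  have h0 := hb.2 m₀ hm₀
  have : ∃ m, IsBridge (insert b' σ) m ∧ ord m < ord b' ∧ ¬ IsBridge σ m := by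
    by_contra! hall
    exact hnot ⟨⟨hσ' hbσ', hb'σ, hlcm⟩, hall⟩ (hlt.trans_le h0)
  obtain ⟨m, hm, hmb', hmσ⟩ := this
  have hmne' : m ≠ b' := by rintro rfl; exact lt_irrefl _ hmb'
  have hmne : m ≠ b := by rintro rfl; exact lt_asymm hmb' hlt
  have hmσ' : ¬ IsBridge σ' m := fun h => (hb'.2 m h).not_gt hmb'
  rw [isBridge_iff] at hm hmσ hmσ'
  have hm1 : m ∈ σ := (Finset.mem_insert.1 hm.1).resolve_left hmne'
  have hm2 : m ∈ σ' := (hmem m hmne hmne').1 hm1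
  push Not at hmσ hmσ'
  obtain ⟨x, hx, hxσ⟩ := hmσ hm1
  obtain ⟨y, hy, hyσ⟩ := hmσ' hm2
  have hxb : x ∉ b := hxσ b hbσ hmne.symm
  have hyb' : y ∉ b' := hyσ b' hbσ' hmne'.symm
  have hxb' : x ∈ b' := by
    obtain ⟨s, hs, hsm, hxs⟩ := hm.2 x hx
    rcases Finset.mem_insert.1 hs with rfl | hs
    · exact hxs
    · exact absurd hxs (hxσ s hs hsm)
  have hyb : y ∈ b := by
    obtain ⟨s, hs, hsm, hys⟩ := hm.2 y hy
    by_cases h1 : s = b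
    · exact h1 ▸ hys
    have h2 : s ≠ b' := by rintro rfl; exact hyb' hys
    have hs' : s ∈ σ' := (hmem s h1 h2).1 ((Finset.mem_insert.1 hs).resolve_left h2)
    exact absurd hys (hyσ s hs' hsm)
  rcases hcomp m (hσ hm1) b (hσ hbσ) b' (hσ' hbσ') (hmb'.trans hlt) hmb' with h | h
  · exact hyb' (h (Finset.mem_inter.2 ⟨hy, hyb⟩))
  · exact hxb (h (Finset.mem_inter.2 ⟨hx, hxb'⟩))

end Bridges

section RootedTree

variable {V : Type*} {T : SimpleGraph V} {r : V}

theorem IsParent.left_unique (hT : T.IsTree) {u u' v : V} (h : IsParent T r u v)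
    (h' : IsParent T r u' v) : u = u' := by
  obtain ⟨p, hp⟩ := hT.connected.exists_walk_length_eq_dist r u
  obtain ⟨p', hp'⟩ := hT.connected.exists_walk_length_eq_dist r u'
  have hq : (p.concat h.1).IsPath :=
    SimpleGraph.Walk.isPath_of_length_eq_dist _ (by simp [hp, h.2])
  have hq' : (p'.concat h'.1).IsPath :=
    SimpleGraph.Walk.isPath_of_length_eq_dist _ (by simp [hp', h'.2])
  have heq := congrArg SimpleGraph.Walk.penultimate
    ((hT.existsUnique_path r v).unique hq hq')
  simpa using heq

theorem dist_directedPath {t : ℕ} {p : ℕ → V}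
    (hp : ∀ i, i + 1 < t → IsParent T r (p i) (p (i + 1))) :
    ∀ i, i < t → T.dist r (p i) = T.dist r (p 0) + i := by
  intro i
  induction i with
  | zero => simp
  | succ i ih =>
    intro hi
    rw [← (hp i hi).2, ih (by omega), add_assoc]

/-- Directed paths that meet agree above the common vertex. -/
theorem directedPath_eq_of_eq (hT : T.IsTree) {t : ℕ} {p q : ℕ → V}
    (hp : ∀ i, i + 1 < t → IsParent T r (p i) (p (i + 1)))
    (hq : ∀ i, i + 1 < t → IsParent T r (q i) (q (i + 1))) (k : ℕ) :
    ∀ i j, i + k < t → j + k < t → p (i + k) = q (j + k) → p i = q j := by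
  induction k with
  | zero => simp
  | succ k ih =>
    intro i j hi hj h
    refine ih i j (by omega) (by omega) ((hp (i + k) hi).left_unique hT ?_)
    have := hq (j + k) hj
    rwa [add_assoc, ← h] at this

variable [DecidableEq V]

theorem sup_dist_directedPath {t : ℕ} (ht : 0 < t) {p : ℕ → V}
    (hp : ∀ i, i + 1 < t → IsParent T r (p i) (p (i + 1))) :
    ((Finset.range t).image p).sup (T.dist r) = T.dist r (p 0) + (t - 1) := by
  apply le_antisymm
  · simp only [Finset.sup_le_iff, Finset.mem_image, Finset.mem_range]
    rintro _ ⟨i, hi, rfl⟩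
    rw [dist_directedPath hp i hi]
    omega
  · rw [← dist_directedPath hp (t - 1) (by omega)]
    exact Finset.le_sup (Finset.mem_image_of_mem p (Finset.mem_range.2 (by omega)))

/-- If `q` starts no deeper than `p` and contains a vertex of `p`, it contains every vertex of
`p` above it. -/
theorem mem_directedPath_of_le (hT : T.IsTree) {t : ℕ} {p q : ℕ → V}
    (hp : ∀ i, i + 1 < t → IsParent T r (p i) (p (i + 1)))
    (hq : ∀ i, i + 1 < t → IsParent T r (q i) (q (i + 1)))
    (hle : T.dist r (q 0) ≤ T.dist r (p 0)) {i j : ℕ} (hij : i ≤ j) (hj : j < t)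
    (hmem : p j ∈ (Finset.range t).image q) : p i ∈ (Finset.range t).image q := by
  obtain ⟨l, hl, hlj⟩ := Finset.mem_image.1 hmem
  rw [Finset.mem_range] at hl
  have hd := congrArg (T.dist r) hlj
  rw [dist_directedPath hq l hl, dist_directedPath hp j hj] at hd
  refine Finset.mem_image.2 ⟨l - (j - i), Finset.mem_range.2 (by omega), ?_⟩
  refine directedPath_eq_of_eq hT hq hp (j - i) _ _ (by omega) (by omega) ?_
  rwa [show l - (j - i) + (j - i) = l by omega, show i + (j - i) = j by omega]

end RootedTree

/-- The path ideal `I_t(T)` of a finite tree `T` rooted at `r`, `t ≥ 2`: its minimal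
generators are the vertex sets of directed paths `v₁ → v₂ → ⋯ → v_t` (each `v_{i+1}` a
child of `v_i`).  If `T` contains at least one such path, then `I_t(T)` is
bridge-friendly. -/
theorem pathIdeal_rootedTree_bridgeFriendly {V : Type*} [Fintype V] [DecidableEq V]
    (T : SimpleGraph V) (hT : T.IsTree) (r : V) (t : ℕ) (ht : 2 ≤ t)
    (M : Set (Finset V))
    (hM : M = {s | ∃ p : ℕ → V, (∀ i, i + 1 < t → IsParent T r (p i) (p (i + 1))) ∧
      s = (Finset.range t).image p})
    (hMne : M.Nonempty) :
    BridgeFriendly M := by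
  obtain ⟨e⟩ : Nonempty (Finset V ≃ Fin (Fintype.card (Finset V))) :=
    ⟨Fintype.equivFin (Finset V)⟩
  set K := Fintype.card (Finset V)
  set N := Finset.univ.sup (T.dist r)
  let ord : Finset V → ℕ := fun s => (e s : ℕ) + K * (N - s.sup (T.dist r))
  have hmod : ∀ s, ord s % K = e s := fun s => by
    simp only [ord, Nat.add_mul_mod_self_left, Nat.mod_eq_of_lt (e s).isLt]
  have hdepth : ∀ s s', ord s < ord s' → s'.sup (T.dist r) ≤ s.sup (T.dist r) := by
    intro s s' h
    have hs' : s'.sup (T.dist r) ≤ N := Finset.sup_mono (Finset.subset_univ s')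
    have hdiv : ∀ s, ord s / K = N - s.sup (T.dist r) := fun s => by
      simp only [ord, Nat.add_mul_div_left _ _ (Fin.pos (e s)),
        Nat.div_eq_of_lt (e s).isLt, zero_add]
    have := Nat.div_le_div_right (c := K) h.le
    rw [hdiv, hdiv] at this
    omega
  refine bridgeFriendly_of_comparable_traces ord (fun s _ s' _ h => ?_) ?_
  · exact e.injective (Fin.ext (by rw [← hmod, ← hmod, h]))
  subst hM
  rintro _ ⟨p, hp, rfl⟩ _ ⟨q, hq, rfl⟩ _ ⟨q', hq', rfl⟩ h h'
  have hle := hdepth _ _ h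
  have hle' := hdepth _ _ h'
  rw [sup_dist_directedPath (by omega) hp, sup_dist_directedPath (by omega) hq] at hle
  rw [sup_dist_directedPath (by omega) hp, sup_dist_directedPath (by omega) hq'] at hle'
  by_contra! hcon
  obtain ⟨⟨x, hx, hxq'⟩, y, hy, hyq⟩ := hcon.imp Finset.not_subset.1 Finset.not_subset.1
  obtain ⟨hxp, hxq⟩ := Finset.mem_inter.1 hx
  obtain ⟨hyp, hyq'⟩ := Finset.mem_inter.1 hy
  obtain ⟨i, hi, rfl⟩ := Finset.mem_image.1 hxp
  obtain ⟨j, hj, rfl⟩ := Finset.mem_image.1 hyp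
  rw [Finset.mem_range] at hi hj
  rcases le_total i j with hij | hij
  · exact hxq' (mem_directedPath_of_le hT hp hq' (by omega) hij hj hyq')
  · exact hyq (mem_directedPath_of_le hT hp hq (by omega) hij hi hxq)
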